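/- There exists D > 0 depending only on C₀ (one may take D = 1/(16C₀)) such that the following holds: if ε, β > 0 satisfy β ≤ D²ε⁴ and u is an admissible solution of (★★) whose initial datum satisfies ‖u(0,·)‖²_{L²(ℝ)} + ‖u(0,·)‖⁴_{L⁴(ℝ)} + βε²‖∂_x² u(0,·)‖²_{L²(ℝ)} ≤ C₀ as well as ‖u(0,·)‖²_{L²(ℝ)} + β‖∂_x u(0,·)‖²_{L²(ℝ)} + β²‖∂_x² u(0,·)‖²_{L²(ℝ)} ≤ C₀, then there is a constant C depending only on C₀ such that ‖u(t,·)‖_{L⁴(ℝ)} ≤ C for every t > 0. -/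

import Mathlib

open MeasureTheory Real Filter Set

noncomputable section

/-- `mixedD u j k t x`: `j` time derivatives of the `k`-th spatial derivative of `u` at `(t,x)`. -/
def mixedD (u : ℝ → ℝ → ℝ) (j k : ℕ) (t x : ℝ) : ℝ :=
  iteratedDeriv j (fun s => iteratedDeriv k (fun y => u s y) x) t

/-- Squared `L²` norm in the space variable. -/
def sqL2 (f : ℝ → ℝ) : ℝ := ∫ x : ℝ, (f x) ^ 2

/-- `L²` norm in the space variable. -/
def nL2 (f : ℝ → ℝ) : ℝ := Real.sqrt (∫ x : ℝ, (f x) ^ 2)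

/-- `L⁴` norm in the space variable. -/
def nL4 (f : ℝ → ℝ) : ℝ := (∫ x : ℝ, (f x) ^ 4) ^ ((1 : ℝ) / 4)

/-- Admissible solution of the Rosenau–KdV–RLW approximation (★). -/
structure IsAdmissibleKdVRLW (ε β : ℝ) (u : ℝ → ℝ → ℝ) : Prop where
  smooth : ContDiff ℝ (⊤ : ℕ∞) (fun p : ℝ × ℝ => u p.1 p.2)
  pde : ∀ t > (0 : ℝ), ∀ x : ℝ,
    mixedD u 1 0 t x + deriv (fun y => (u t y) ^ 2) x
      + β * mixedD u 0 3 t x - β * mixedD u 1 2 t x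
      + β ^ 2 * mixedD u 1 4 t x = ε * mixedD u 0 2 t x
  sq_int : ∀ T > (0 : ℝ), ∀ j k : ℕ, j + k ≤ 5 → ∀ t ∈ Set.Icc (0 : ℝ) T,
    MeasureTheory.Integrable (fun x : ℝ => (mixedD u j k t x) ^ 2)
  decay : ∀ T > (0 : ℝ), ∀ j k : ℕ, j + k ≤ 5 → ∀ δ > (0 : ℝ), ∃ M : ℝ,
    ∀ x : ℝ, M ≤ |x| → ∀ t ∈ Set.Icc (0 : ℝ) T, |mixedD u j k t x| ≤ δ

/-- Admissible solution of the Rosenau–RLW approximation (★★). -/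
structure IsAdmissibleRLW (ε β : ℝ) (u : ℝ → ℝ → ℝ) : Prop where
  smooth : ContDiff ℝ (⊤ : ℕ∞) (fun p : ℝ × ℝ => u p.1 p.2)
  pde : ∀ t > (0 : ℝ), ∀ x : ℝ,
    mixedD u 1 0 t x + deriv (fun y => (u t y) ^ 2) x
      - β * mixedD u 1 2 t x + β ^ 2 * mixedD u 1 4 t x = ε * mixedD u 0 2 t x
  sq_int : ∀ T > (0 : ℝ), ∀ j k : ℕ, j + k ≤ 5 → ∀ t ∈ Set.Icc (0 : ℝ) T,
    MeasureTheory.Integrable (fun x : ℝ => (mixedD u j k t x) ^ 2)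
  decay : ∀ T > (0 : ℝ), ∀ j k : ℕ, j + k ≤ 5 → ∀ δ > (0 : ℝ), ∃ M : ℝ,
    ∀ x : ℝ, M ≤ |x| → ∀ t ∈ Set.Icc (0 : ℝ) T, |mixedD u j k t x| ≤ δ

/-- Data bounds with constant `C0` for the (★) approximation. -/
def DataBoundsKdVRLW (ε β C0 : ℝ) (f : ℝ → ℝ) : Prop :=
  (∫ x : ℝ, (f x) ^ 2) + (∫ x : ℝ, (f x) ^ 4)
      + (β + ε ^ 2) * (∫ x : ℝ, (deriv f x) ^ 2) ≤ C0 ∧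
  (β * ε + β * ε ^ 2 + β ^ 2) * (∫ x : ℝ, (iteratedDeriv 2 f x) ^ 2)
      + (β ^ 2 * ε ^ 2 + β ^ 3) * (∫ x : ℝ, (iteratedDeriv 3 f x) ^ 2) ≤ C0 ∧
  β ^ 4 * (∫ x : ℝ, (iteratedDeriv 4 f x) ^ 2) ≤ C0

/-- Data bounds with constant `C0` for the (★★) approximation. -/
def DataBoundsRLW (ε β C0 : ℝ) (f : ℝ → ℝ) : Prop :=
  (∫ x : ℝ, (f x) ^ 2) + (∫ x : ℝ, (f x) ^ 4)
    + β * ε ^ 2 * (∫ x : ℝ, (iteratedDeriv 2 f x) ^ 2) ≤ C0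

/-- `u ∈ L^∞((0,∞); L²(ℝ) ∩ L⁴(ℝ))`. -/
def BddL2L4 (u : ℝ → ℝ → ℝ) : Prop :=
  ∃ M : ℝ, ∀ t > (0 : ℝ), (∫ x : ℝ, (u t x) ^ 2) ≤ M ∧ (∫ x : ℝ, (u t x) ^ 4) ≤ M

/-- Entropy solution of `∂ₜ u + ∂ₓ (u²) = 0` with initial datum `u0`. -/
def IsEntropySolution (u : ℝ → ℝ → ℝ) (u0 : ℝ → ℝ) : Prop :=
  ∀ η : ℝ → ℝ, ContDiff ℝ 2 η → ConvexOn ℝ Set.univ η →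
    (∃ M : ℝ, ∀ v : ℝ, |deriv η v| ≤ M) →
    ∀ φ : ℝ → ℝ → ℝ, ContDiff ℝ (⊤ : ℕ∞) (fun p : ℝ × ℝ => φ p.1 p.2) →
      HasCompactSupport (fun p : ℝ × ℝ => φ p.1 p.2) →
      (∀ t x : ℝ, 0 ≤ φ t x) →
      0 ≤ (∫ t in Set.Ioi (0 : ℝ), ∫ x : ℝ,
            (η (u t x) * deriv (fun s => φ s x) t
              + (∫ ξ in (0 : ℝ)..(u t x), 2 * ξ * deriv η ξ) * deriv (fun y => φ t y) x))
          + ∫ x : ℝ, η (u0 x) * φ 0 x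

section PartialDerivatives

variable {g : ℝ → ℝ → ℝ}

/-- The time slice of a smooth function has the partial derivative `fderiv _ _ (1, 0)`. -/
lemma hasDerivAt_fst_of_contDiff (hg : ContDiff ℝ (⊤ : ℕ∞) (fun p : ℝ × ℝ => g p.1 p.2))
    (t x : ℝ) :
    HasDerivAt (fun s => g s x) (fderiv ℝ (fun p : ℝ × ℝ => g p.1 p.2) (t, x) (1, 0)) t := by
  have h := (hg.differentiable (by simp) (t, x)).hasFDerivAt
  exact h.comp_hasDerivAt (f := fun s => (s, x)) t ((hasDerivAt_id t).prodMk (hasDerivAt_const t x))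

/-- The space slice of a smooth function has the partial derivative `fderiv _ _ (0, 1)`. -/
lemma hasDerivAt_snd_of_contDiff (hg : ContDiff ℝ (⊤ : ℕ∞) (fun p : ℝ × ℝ => g p.1 p.2))
    (t x : ℝ) :
    HasDerivAt (fun y => g t y) (fderiv ℝ (fun p : ℝ × ℝ => g p.1 p.2) (t, x) (0, 1)) x := by
  have h := (hg.differentiable (by simp) (t, x)).hasFDerivAt
  exact h.comp_hasDerivAt (f := fun y => (t, y)) x ((hasDerivAt_const x t).prodMk (hasDerivAt_id x))

lemma contDiff_deriv_fst (hg : ContDiff ℝ (⊤ : ℕ∞) (fun p : ℝ × ℝ => g p.1 p.2)) :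
    ContDiff ℝ (⊤ : ℕ∞) (fun p : ℝ × ℝ => deriv (fun s => g s p.2) p.1) := by
  simp only [(hasDerivAt_fst_of_contDiff hg _ _).deriv]
  exact (hg.fderiv_right (by simp)).clm_apply contDiff_const

lemma contDiff_deriv_snd (hg : ContDiff ℝ (⊤ : ℕ∞) (fun p : ℝ × ℝ => g p.1 p.2)) :
    ContDiff ℝ (⊤ : ℕ∞) (fun p : ℝ × ℝ => deriv (fun y => g p.1 y) p.2) := by
  simp only [(hasDerivAt_snd_of_contDiff hg _ _).deriv]
  exact (hg.fderiv_right (by simp)).clm_apply contDiff_const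

/-- Mixed partial derivatives of a smooth function commute. -/
lemma deriv_deriv_comm (hg : ContDiff ℝ (⊤ : ℕ∞) (fun p : ℝ × ℝ => g p.1 p.2)) (t x : ℝ) :
    deriv (fun y => deriv (fun s => g s y) t) x = deriv (fun s => deriv (fun y => g s y) x) t := by
  have hsymm : IsSymmSndFDerivAt ℝ (fun p : ℝ × ℝ => g p.1 p.2) (t, x) :=
    hg.contDiffAt.isSymmSndFDerivAt (by
      simpa using (WithTop.coe_le_coe.2 le_top : ((2 : ℕ∞) : WithTop ℕ∞) ≤ ((⊤ : ℕ∞) : WithTop ℕ∞)))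
  have hd : HasFDerivAt (fderiv ℝ (fun p : ℝ × ℝ => g p.1 p.2))
      (fderiv ℝ (fderiv ℝ (fun p : ℝ × ℝ => g p.1 p.2)) (t, x)) (t, x) :=
    ((hg.fderiv_right (m := (⊤ : ℕ∞)) (by simp)).differentiable (by simp) _).hasFDerivAt
  simp only [(hasDerivAt_fst_of_contDiff hg _ _).deriv, (hasDerivAt_snd_of_contDiff hg _ _).deriv]
  have h1 := (hd.comp_hasDerivAt (f := fun y => (t, y)) x
    ((hasDerivAt_const x t).prodMk (hasDerivAt_id x))).clm_apply
      (hasDerivAt_const x ((1, 0) : ℝ × ℝ))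
  have h2 := (hd.comp_hasDerivAt (f := fun s => (s, x)) t
    ((hasDerivAt_id t).prodMk (hasDerivAt_const t x))).clm_apply
      (hasDerivAt_const t ((0, 1) : ℝ × ℝ))
  have e1 := h1.deriv
  have e2 := h2.deriv
  simp only [map_zero, add_zero, Function.comp_def] at e1 e2
  rw [e1, e2]
  exact hsymm _ _

variable {u : ℝ → ℝ → ℝ}

lemma mixedD_zero_zero : mixedD u 0 0 = u := by
  funext t x
  simp [mixedD]

lemma mixedD_zero_succ (k : ℕ) (t x : ℝ) :
    mixedD u 0 (k + 1) t x = deriv (fun y => mixedD u 0 k t y) x := by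
  simp [mixedD, iteratedDeriv_succ]

lemma mixedD_succ (j k : ℕ) (t x : ℝ) :
    mixedD u (j + 1) k t x = deriv (fun s => mixedD u j k s x) t := by
  simp [mixedD, iteratedDeriv_succ]

lemma contDiff_mixedD (hu : ContDiff ℝ (⊤ : ℕ∞) (fun p : ℝ × ℝ => u p.1 p.2)) (j k : ℕ) :
    ContDiff ℝ (⊤ : ℕ∞) (fun p : ℝ × ℝ => mixedD u j k p.1 p.2) := by
  induction j with
  | zero =>
    induction k with
    | zero => simpa only [mixedD_zero_zero] using hu
    | succ k ih =>
      simp only [mixedD_zero_succ]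
      exact contDiff_deriv_snd ih
  | succ j ih =>
    simp only [mixedD_succ]
    exact contDiff_deriv_fst ih

lemma mixedD_succ_right (hu : ContDiff ℝ (⊤ : ℕ∞) (fun p : ℝ × ℝ => u p.1 p.2)) (j k : ℕ)
    (t x : ℝ) : mixedD u j (k + 1) t x = deriv (fun y => mixedD u j k t y) x := by
  induction j generalizing t x with
  | zero => exact mixedD_zero_succ k t x
  | succ j ih =>
    simp only [mixedD_succ, ih]
    exact (deriv_deriv_comm (contDiff_mixedD hu j k) t x).symm

lemma hasDerivAt_mixedD_fst (hu : ContDiff ℝ (⊤ : ℕ∞) (fun p : ℝ × ℝ => u p.1 p.2)) (j k : ℕ)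
    (t x : ℝ) : HasDerivAt (fun s => mixedD u j k s x) (mixedD u (j + 1) k t x) t := by
  rw [mixedD_succ]
  exact (hasDerivAt_fst_of_contDiff (contDiff_mixedD hu j k) t x).differentiableAt.hasDerivAt

lemma hasDerivAt_mixedD_snd (hu : ContDiff ℝ (⊤ : ℕ∞) (fun p : ℝ × ℝ => u p.1 p.2)) (j k : ℕ)
    (t x : ℝ) : HasDerivAt (fun y => mixedD u j k t y) (mixedD u j (k + 1) t x) x := by
  rw [mixedD_succ_right hu]
  exact (hasDerivAt_snd_of_contDiff (contDiff_mixedD hu j k) t x).differentiableAt.hasDerivAt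

lemma continuous_mixedD (hu : ContDiff ℝ (⊤ : ℕ∞) (fun p : ℝ × ℝ => u p.1 p.2)) (j k : ℕ) :
    Continuous (fun p : ℝ × ℝ => mixedD u j k p.1 p.2) :=
  (contDiff_mixedD hu j k).continuous

end PartialDerivatives

/-- The filter describing `|x| → ∞` uniformly for times in `[0, T]`. -/
abbrev spatialInfinity (T : ℝ) : Filter (ℝ × ℝ) :=
  𝓟 (Icc 0 T) ×ˢ comap (fun x : ℝ => |x|) atTop

/-- Vanishing along `spatialInfinity T`, as an explicit bound outside a compact interval. -/
lemma tendsto_spatialInfinity_iff {T : ℝ} {G : ℝ → ℝ → ℝ} :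
    Tendsto (fun p : ℝ × ℝ => G p.1 p.2) (spatialInfinity T) (nhds 0) ↔
      ∀ δ > (0 : ℝ), ∃ M : ℝ, ∀ x : ℝ, M ≤ |x| → ∀ t ∈ Icc (0 : ℝ) T, |G t x| ≤ δ := by
  have hb : (spatialInfinity T).HasBasis (fun _ : ℝ => True)
      (fun M => Icc 0 T ×ˢ ((fun x : ℝ => |x|) ⁻¹' Ici M)) :=
    (atTop_basis.comap _).principal_prod _
  rw [hb.tendsto_iff Metric.nhds_basis_closedBall]
  constructor
  · intro h δ hδ
    obtain ⟨M, -, hM⟩ := h δ hδ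
    exact ⟨M, fun x hx t ht => by simpa using hM (t, x) ⟨ht, hx⟩⟩
  · intro h δ hδ
    obtain ⟨M, hM⟩ := h δ hδ
    exact ⟨M, trivial, fun p hp => by simpa using hM p.2 hp.2 p.1 hp.1⟩

/-- If `∂ₜ f ≤ ∂ₓ G` and the flux `G` vanishes as `|x| → ∞` uniformly in time, then the total mass
of `f` does not increase. -/
lemma integral_le_of_deriv_le_flux {T : ℝ} (hT : 0 ≤ T) {f f' G G' : ℝ → ℝ → ℝ}
    (hf : ∀ t x, HasDerivAt (fun s => f s x) (f' t x) t)
    (hG : ∀ t x, HasDerivAt (fun y => G t y) (G' t x) x)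
    (hf' : Continuous (fun p : ℝ × ℝ => f' p.1 p.2))
    (hGc : Continuous (fun p : ℝ × ℝ => G p.1 p.2))
    (hG' : Continuous (fun p : ℝ × ℝ => G' p.1 p.2))
    (hle : ∀ t ∈ Ioc 0 T, ∀ x, f' t x ≤ G' t x)
    (hdecay : Tendsto (fun p : ℝ × ℝ => G p.1 p.2) (spatialInfinity T) (nhds 0))
    (hint0 : Integrable (f 0)) (hintT : Integrable (f T)) :
    ∫ x, f T x ≤ ∫ x, f 0 x := by
  have hc1 : ∀ t, Continuous (f' t) := fun t => hf'.comp (by fun_prop : Continuous fun x => (t, x))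
  have hc2 : ∀ x, Continuous (fun t => f' t x) :=
    fun x => hf'.comp (by fun_prop : Continuous fun t => (t, x))
  have hc3 : ∀ t, Continuous (G' t) := fun t => hG'.comp (by fun_prop : Continuous fun x => (t, x))
  have hc4 : ∀ x, Continuous (fun t => G t x) :=
    fun x => hGc.comp (by fun_prop : Continuous fun t => (t, x))
  have hkey : ∀ R : ℝ, 0 ≤ R →
      (∫ x in (-R)..R, (f T x - f 0 x)) ≤ ∫ t in (0 : ℝ)..T, (G t R - G t (-R)) := by
    intro R hR
    have h1 : ∀ x, f T x - f 0 x = ∫ t in (0 : ℝ)..T, f' t x := fun x =>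
      (intervalIntegral.integral_eq_sub_of_hasDerivAt (fun t _ => hf t x)
        ((hc2 x).intervalIntegrable _ _)).symm
    have h2 : ∀ t, (∫ x in (-R)..R, G' t x) = G t R - G t (-R) := fun t =>
      intervalIntegral.integral_eq_sub_of_hasDerivAt (fun x _ => hG t x)
        ((hc3 t).intervalIntegrable _ _)
    simp only [h1]
    rw [intervalIntegral_intervalIntegral_swap]
    · refine intervalIntegral.integral_mono_on_of_le_Ioo hT ?_ ?_ ?_
      · exact (intervalIntegral.continuous_parametric_intervalIntegral_of_continuous' hf' _ _
          ).intervalIntegrable _ _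
      · exact ((hc4 R).sub (hc4 (-R))).intervalIntegrable _ _
      · intro t ht
        rw [← h2]
        exact intervalIntegral.integral_mono_on (by linarith) ((hc1 t).intervalIntegrable _ _)
          ((hc3 t).intervalIntegrable _ _) fun x _ => hle t ⟨ht.1, ht.2.le⟩ x
    · have hsw : Continuous (Function.uncurry fun x t => f' t x) := hf'.comp continuous_swap
      exact (hsw.continuousOn.integrableOn_compact (isCompact_uIcc.prod isCompact_uIcc)).mono_set
        (prod_mono uIoc_subset_uIcc uIoc_subset_uIcc)
  have hlim : Tendsto (fun R : ℝ => ∫ x in (-R)..R, (f T x - f 0 x)) atTop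
      (nhds (∫ x, (f T x - f 0 x))) :=
    intervalIntegral_tendsto_integral (hintT.sub hint0) tendsto_neg_atTop_atBot tendsto_id
  rw [integral_sub hintT hint0] at hlim
  refine sub_nonpos.1 (le_of_forall_pos_le_add fun δ hδ => ?_)
  have hη : 0 < δ / (2 * (T + 1)) := by positivity
  obtain ⟨M, hM⟩ := tendsto_spatialInfinity_iff.1 hdecay _ hη
  refine le_of_tendsto hlim ?_
  filter_upwards [eventually_ge_atTop M, eventually_ge_atTop 0] with R hRM hR
  refine (hkey R hR).trans ?_
  have hbound : (∫ t in (0 : ℝ)..T, (G t R - G t (-R))) ≤ ∫ _ in (0 : ℝ)..T, δ / (T + 1) := by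
    refine intervalIntegral.integral_mono_on hT
      (((hc4 R).sub (hc4 (-R))).intervalIntegrable _ _) (by simp) fun t ht => ?_
    have h1 := abs_le.1 (hM R (by rwa [abs_of_nonneg hR]) t ht)
    have h2 := abs_le.1 (hM (-R) (by rwa [abs_neg, abs_of_nonneg hR]) t ht)
    have h3 : δ / (T + 1) = 2 * (δ / (2 * (T + 1))) := by field_simp
    linarith [h1.2, h2.1]
  refine hbound.trans ?_
  rw [intervalIntegral.integral_const, smul_eq_mul, sub_zero, zero_add, mul_div_assoc',
    div_le_iff₀ (by positivity)]
  nlinarith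

/-- One-dimensional Agmon-type inequality: `a v² ≤ ∫ (v² + a² v'²)`. -/
lemma mul_sq_le_integral_sq_add_sq (a : ℝ) {v v' : ℝ → ℝ}
    (hv : ∀ x, HasDerivAt v (v' x) x) (hv' : Continuous v')
    (h_integrable : Integrable fun x => v x ^ 2 + a ^ 2 * v' x ^ 2) (hlim : Tendsto v atBot (nhds 0))
    (x : ℝ) : a * v x ^ 2 ≤ ∫ y, (v y ^ 2 + a ^ 2 * v' y ^ 2) := by
  have hvc : Continuous v := continuous_iff_continuousAt.2 fun x => (hv x).continuousAt
  have hbound : ∀ y ≤ x, a * v x ^ 2 - a * v y ^ 2 ≤ ∫ z, (v z ^ 2 + a ^ 2 * v' z ^ 2) := by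
    intro y hy
    have hd : ∀ z, HasDerivAt (fun z => a * v z ^ 2) (2 * a * v z * v' z) z := fun z => by
      refine (((hv z).pow 2).const_mul a).congr_deriv ?_
      push_cast
      ring
    rw [← intervalIntegral.integral_eq_sub_of_hasDerivAt (fun z _ => hd z)
      ((by fun_prop : Continuous fun z => 2 * a * v z * v' z).intervalIntegrable y x)]
    calc (∫ z in y..x, 2 * a * v z * v' z)
        ≤ ∫ z in y..x, (v z ^ 2 + a ^ 2 * v' z ^ 2) :=
          intervalIntegral.integral_mono_on hy
            ((by fun_prop : Continuous fun z => 2 * a * v z * v' z).intervalIntegrable y x)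
            h_integrable.intervalIntegrable fun z _ => by nlinarith [sq_nonneg (v z - a * v' z)]
      _ ≤ ∫ z, (v z ^ 2 + a ^ 2 * v' z ^ 2) := by
          rw [intervalIntegral.integral_of_le hy]
          exact setIntegral_le_integral h_integrable (ae_of_all _ fun z => by positivity)
  have htend : Tendsto (fun y => a * v x ^ 2 - a * v y ^ 2) atBot
      (nhds (a * v x ^ 2 - a * 0 ^ 2)) := tendsto_const_nhds.sub ((hlim.pow 2).const_mul a)
  simp only [ne_eq, OfNat.ofNat_ne_zero, not_false_eq_true, zero_pow, mul_zero, sub_zero] at htend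
  exact le_of_tendsto htend ((eventually_le_atBot x).mono hbound)

namespace IsAdmissibleRLW

variable {ε β : ℝ} {u : ℝ → ℝ → ℝ}

lemma tendsto_mixedD (h : IsAdmissibleRLW ε β u) {T : ℝ} (hT : 0 < T) {j k : ℕ}
    (hjk : j + k ≤ 5) :
    Tendsto (fun p : ℝ × ℝ => mixedD u j k p.1 p.2) (spatialInfinity T) (nhds 0) :=
  tendsto_spatialInfinity_iff.2 (h.decay T hT j k hjk)

lemma integrable_mixedD_sq (h : IsAdmissibleRLW ε β u) {t : ℝ} (ht : 0 ≤ t) {j k : ℕ}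
    (hjk : j + k ≤ 5) : Integrable (fun x => mixedD u j k t x ^ 2) :=
  h.sq_int (t + 1) (by linarith) j k hjk t ⟨ht, by linarith⟩

lemma tendsto_mixedD_atBot (h : IsAdmissibleRLW ε β u) {t : ℝ} (ht : 0 ≤ t) {j k : ℕ}
    (hjk : j + k ≤ 5) : Tendsto (mixedD u j k t) atBot (nhds 0) := by
  refine (h.tendsto_mixedD (by linarith : 0 < t + 1) hjk).comp (f := fun x => (t, x))
    (Tendsto.prodMk ?_ ?_)
  · exact tendsto_principal.2 (Eventually.of_forall fun _ => ⟨ht, by linarith⟩)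
  · exact tendsto_comap_iff.2 tendsto_abs_atBot_atTop

lemma equation (h : IsAdmissibleRLW ε β u) {t : ℝ} (ht : 0 < t) (x : ℝ) :
    mixedD u 1 0 t x + 2 * mixedD u 0 0 t x * mixedD u 0 1 t x - β * mixedD u 1 2 t x
      + β ^ 2 * mixedD u 1 4 t x = ε * mixedD u 0 2 t x := by
  have hd : deriv (fun y => u t y ^ 2) x = 2 * mixedD u 0 0 t x * mixedD u 0 1 t x := by
    have hx := hasDerivAt_mixedD_snd h.smooth 0 0 t x
    rw [mixedD_zero_zero] at hx ⊢
    exact ((hx.pow 2).congr_deriv (by push_cast; ring)).deriv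
  rw [← hd]
  exact h.pde t ht x

/-- The energy `‖u‖² + β ‖∂ₓ u‖² + β² ‖∂ₓ² u‖²` does not increase. -/
lemma energy_le (h : IsAdmissibleRLW ε β u) (hε : 0 ≤ ε) {T : ℝ} (hT : 0 < T) :
    (∫ x, (mixedD u 0 0 T x ^ 2 + β * mixedD u 0 1 T x ^ 2 + β ^ 2 * mixedD u 0 2 T x ^ 2)) ≤
      ∫ x, (mixedD u 0 0 0 x ^ 2 + β * mixedD u 0 1 0 x ^ 2 + β ^ 2 * mixedD u 0 2 0 x ^ 2) := by
  have hc := continuous_mixedD h.smooth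
  have h_integrable : ∀ t, 0 ≤ t → Integrable fun x =>
      mixedD u 0 0 t x ^ 2 + β * mixedD u 0 1 t x ^ 2 + β ^ 2 * mixedD u 0 2 t x ^ 2 := fun t ht =>
    ((h.integrable_mixedD_sq ht (by norm_num)).add
      ((h.integrable_mixedD_sq ht (by norm_num)).const_mul β)).add
      ((h.integrable_mixedD_sq ht (by norm_num)).const_mul (β ^ 2))
  have ct := hasDerivAt_mixedD_fst h.smooth
  have cx := hasDerivAt_mixedD_snd h.smooth
  refine integral_le_of_deriv_le_flux hT.le
    (f := fun t x => mixedD u 0 0 t x ^ 2 + β * mixedD u 0 1 t x ^ 2 + β ^ 2 * mixedD u 0 2 t x ^ 2)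
    (f' := fun t x => 2 * (mixedD u 0 0 t x * mixedD u 1 0 t x
      + β * (mixedD u 0 1 t x * mixedD u 1 1 t x)
      + β ^ 2 * (mixedD u 0 2 t x * mixedD u 1 2 t x)))
    (G := fun t x => 2 * (-(2 / 3) * mixedD u 0 0 t x ^ 3 + β * (mixedD u 0 0 t x * mixedD u 1 1 t x)
      - β ^ 2 * (mixedD u 0 0 t x * mixedD u 1 3 t x)
      + β ^ 2 * (mixedD u 0 1 t x * mixedD u 1 2 t x) + ε * (mixedD u 0 0 t x * mixedD u 0 1 t x)))
    (G' := fun t x => 2 * (-2 * mixedD u 0 0 t x ^ 2 * mixedD u 0 1 t x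
      + β * (mixedD u 0 1 t x * mixedD u 1 1 t x + mixedD u 0 0 t x * mixedD u 1 2 t x)
      - β ^ 2 * (mixedD u 0 1 t x * mixedD u 1 3 t x + mixedD u 0 0 t x * mixedD u 1 4 t x)
      + β ^ 2 * (mixedD u 0 2 t x * mixedD u 1 2 t x + mixedD u 0 1 t x * mixedD u 1 3 t x)
      + ε * (mixedD u 0 1 t x * mixedD u 0 1 t x + mixedD u 0 0 t x * mixedD u 0 2 t x)))
    ?_ ?_ (by fun_prop) (by fun_prop) (by fun_prop) ?_ ?_ (h_integrable 0 le_rfl) (h_integrable T hT.le)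
  · intro t x
    refine ((((ct 0 0 t x).pow 2).add (((ct 0 1 t x).pow 2).const_mul β)).add
      (((ct 0 2 t x).pow 2).const_mul (β ^ 2))).congr_deriv ?_
    push_cast
    ring
  · intro t x
    refine (((((((cx 0 0 t x).pow 3).const_mul (-(2 / 3))).add
      (((cx 0 0 t x).mul (cx 1 1 t x)).const_mul β)).sub
      (((cx 0 0 t x).mul (cx 1 3 t x)).const_mul (β ^ 2))).add
      (((cx 0 1 t x).mul (cx 1 2 t x)).const_mul (β ^ 2))).add
      (((cx 0 0 t x).mul (cx 0 1 t x)).const_mul ε)).const_mul 2 |>.congr_deriv ?_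
    push_cast
    ring
  · intro t ht x
    have hpos : 0 ≤ ε * mixedD u 0 1 t x ^ 2 := by positivity
    linear_combination 2 * hpos + 2 * mixedD u 0 0 t x * h.equation ht.1 x
  · have d00 := h.tendsto_mixedD hT (j := 0) (k := 0) (by norm_num)
    have d01 := h.tendsto_mixedD hT (j := 0) (k := 1) (by norm_num)
    have d11 := h.tendsto_mixedD hT (j := 1) (k := 1) (by norm_num)
    have d12 := h.tendsto_mixedD hT (j := 1) (k := 2) (by norm_num)
    have d13 := h.tendsto_mixedD hT (j := 1) (k := 3) (by norm_num)
    simpa using (((((d00.pow 3).const_mul (-(2 / 3))).add ((d00.mul d11).const_mul β)).sub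
      ((d00.mul d13).const_mul (β ^ 2))).add ((d01.mul d12).const_mul (β ^ 2))).add
      ((d00.mul d01).const_mul ε) |>.const_mul 2

/-- A bound on the initial energy controls the solution uniformly in space and time. -/
lemma sqrt_mul_sq_le (h : IsAdmissibleRLW ε β u) (hε : 0 ≤ ε) (hβ : 0 ≤ β) {C0 : ℝ}
    (hE : sqL2 (u 0) + β * sqL2 (fun x => mixedD u 0 1 0 x)
      + β ^ 2 * sqL2 (fun x => mixedD u 0 2 0 x) ≤ C0) {t : ℝ} (ht : 0 ≤ t) (x : ℝ) :
    √β * u t x ^ 2 ≤ C0 := by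
  have hi : ∀ s, 0 ≤ s → ∀ c k, k ≤ 5 → Integrable fun x => c * mixedD u 0 k s x ^ 2 :=
    fun s hs c k hk => (h.integrable_mixedD_sq hs (by omega)).const_mul c
  have hi0 : ∀ s, 0 ≤ s → Integrable fun x => mixedD u 0 0 s x ^ 2 :=
    fun s hs => h.integrable_mixedD_sq hs (by norm_num)
  have h_integrable : ∀ s, 0 ≤ s → Integrable fun x => mixedD u 0 0 s x ^ 2 + β * mixedD u 0 1 s x ^ 2 :=
    fun s hs => (hi0 s hs).add (hi s hs β 1 (by norm_num))
  have hcont : Continuous (mixedD u 0 1 t) :=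
    continuous_iff_continuousAt.2 fun y => (hasDerivAt_mixedD_snd h.smooth 0 1 t y).continuousAt
  have hsup := mul_sq_le_integral_sq_add_sq (√β) (v := mixedD u 0 0 t) (v' := mixedD u 0 1 t)
    (hasDerivAt_mixedD_snd h.smooth 0 0 t) hcont
    (by simpa only [Real.sq_sqrt hβ] using h_integrable t ht) (h.tendsto_mixedD_atBot ht (by norm_num)) x
  simp only [Real.sq_sqrt hβ] at hsup
  have hinit : (∫ x, (mixedD u 0 0 0 x ^ 2 + β * mixedD u 0 1 0 x ^ 2
      + β ^ 2 * mixedD u 0 2 0 x ^ 2)) ≤ C0 := by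
    rw [integral_add (h_integrable 0 le_rfl) (hi 0 le_rfl (β ^ 2) 2 (by norm_num)),
      integral_add (hi0 0 le_rfl) (hi 0 le_rfl β 1 (by norm_num)),
      integral_const_mul, integral_const_mul]
    simpa only [sqL2, mixedD_zero_zero] using hE
  have hmono : (∫ x, (mixedD u 0 0 t x ^ 2 + β * mixedD u 0 1 t x ^ 2)) ≤
      ∫ x, (mixedD u 0 0 t x ^ 2 + β * mixedD u 0 1 t x ^ 2 + β ^ 2 * mixedD u 0 2 t x ^ 2) :=
    integral_mono (h_integrable t ht) ((h_integrable t ht).add (hi t ht (β ^ 2) 2 (by norm_num))) fun x =>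
      le_add_of_nonneg_right (by positivity)
  have henergy : (∫ x, (mixedD u 0 0 t x ^ 2 + β * mixedD u 0 1 t x ^ 2
      + β ^ 2 * mixedD u 0 2 t x ^ 2)) ≤ C0 := by
    rcases ht.eq_or_lt with rfl | ht
    · exact hinit
    · exact (h.energy_le hε ht).trans hinit
  have hfinal := hsup.trans (hmono.trans henergy)
  rwa [mixedD_zero_zero] at hfinal

/-- If `u` is bounded at time `t`, then `u(t, ·)⁴` is integrable. -/
lemma integrable_pow_four (h : IsAdmissibleRLW ε β u) {t K : ℝ} (ht : 0 ≤ t)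
    (hK : ∀ x, u t x ^ 2 ≤ K) : Integrable fun x => u t x ^ 4 := by
  have hi := h.integrable_mixedD_sq ht (j := 0) (k := 0) (by norm_num)
  have hc : Continuous (u t) := h.smooth.continuous.comp (by fun_prop : Continuous fun x => (t, x))
  rw [mixedD_zero_zero] at hi
  refine (hi.const_mul K).mono' (hc.pow 4).aestronglyMeasurable (ae_of_all _ fun x => ?_)
  rw [Real.norm_of_nonneg (by positivity)]
  nlinarith [hK x, sq_nonneg (u t x)]

/-- The functional `‖u‖₄⁴ + 2 β ε² ‖∂ₓ² u‖²` does not increase, provided `16 β u² ≤ ε²`. -/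
lemma integral_pow_four_add_le (h : IsAdmissibleRLW ε β u) (hε : 0 < ε) (hβ : 0 < β)
    (hsup : ∀ t, 0 ≤ t → ∀ x, 16 * (β * u t x ^ 2) ≤ ε ^ 2) {T : ℝ} (hT : 0 < T) :
    (∫ x, (u T x ^ 4 + 2 * β * ε ^ 2 * mixedD u 0 2 T x ^ 2)) ≤
      ∫ x, (u 0 x ^ 4 + 2 * β * ε ^ 2 * mixedD u 0 2 0 x ^ 2) := by
  have hc := continuous_mixedD h.smooth
  have h_integrable : ∀ t, 0 ≤ t → Integrable fun x =>
      mixedD u 0 0 t x ^ 4 + 2 * β * ε ^ 2 * mixedD u 0 2 t x ^ 2 := fun t ht => by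
    refine Integrable.add ?_ ((h.integrable_mixedD_sq ht (by norm_num)).const_mul _)
    rw [mixedD_zero_zero]
    refine h.integrable_pow_four ht (K := ε ^ 2 / (16 * β)) fun x => ?_
    rw [le_div_iff₀ (by positivity)]
    linarith [hsup t ht x]
  have ct := hasDerivAt_mixedD_fst h.smooth
  have cx := hasDerivAt_mixedD_snd h.smooth
  have hmain := integral_le_of_deriv_le_flux hT.le
    (f := fun t x => mixedD u 0 0 t x ^ 4 + 2 * β * ε ^ 2 * mixedD u 0 2 t x ^ 2)
    (f' := fun t x => 4 * (mixedD u 0 0 t x ^ 3 * mixedD u 1 0 t x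
      + β * ε ^ 2 * (mixedD u 0 2 t x * mixedD u 1 2 t x)))
    (G := fun t x => 4 * (-(2 / 5) * mixedD u 0 0 t x ^ 5
      + β * (mixedD u 0 0 t x ^ 3 * mixedD u 1 1 t x)
      - β ^ 2 * (mixedD u 0 0 t x ^ 3 * mixedD u 1 3 t x)
      + ε * (mixedD u 0 0 t x ^ 3 * mixedD u 0 1 t x)
      + β * ε * (mixedD u 1 1 t x * mixedD u 1 0 t x)
      + β ^ 3 * ε * (mixedD u 1 2 t x * mixedD u 1 3 t x)))
    (G' := fun t x => 4 * (-2 * mixedD u 0 0 t x ^ 4 * mixedD u 0 1 t x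
      + β * (3 * mixedD u 0 0 t x ^ 2 * mixedD u 0 1 t x * mixedD u 1 1 t x
        + mixedD u 0 0 t x ^ 3 * mixedD u 1 2 t x)
      - β ^ 2 * (3 * mixedD u 0 0 t x ^ 2 * mixedD u 0 1 t x * mixedD u 1 3 t x
        + mixedD u 0 0 t x ^ 3 * mixedD u 1 4 t x)
      + ε * (3 * mixedD u 0 0 t x ^ 2 * mixedD u 0 1 t x ^ 2
        + mixedD u 0 0 t x ^ 3 * mixedD u 0 2 t x)
      + β * ε * (mixedD u 1 2 t x * mixedD u 1 0 t x + mixedD u 1 1 t x ^ 2)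
      + β ^ 3 * ε * (mixedD u 1 3 t x ^ 2 + mixedD u 1 2 t x * mixedD u 1 4 t x)))
    ?_ ?_ (by fun_prop) (by fun_prop) (by fun_prop) ?_ ?_ (h_integrable 0 le_rfl) (h_integrable T hT.le)
  · simpa only [mixedD_zero_zero] using hmain
  · intro t x
    refine (((ct 0 0 t x).pow 4).add (((ct 0 2 t x).pow 2).const_mul (2 * β * ε ^ 2))).congr_deriv ?_
    push_cast
    ring
  · intro t x
    refine ((((((((cx 0 0 t x).pow 5).const_mul (-(2 / 5))).add
      ((((cx 0 0 t x).pow 3).mul (cx 1 1 t x)).const_mul β)).sub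
      ((((cx 0 0 t x).pow 3).mul (cx 1 3 t x)).const_mul (β ^ 2))).add
      ((((cx 0 0 t x).pow 3).mul (cx 0 1 t x)).const_mul ε)).add
      (((cx 1 1 t x).mul (cx 1 0 t x)).const_mul (β * ε))).add
      (((cx 1 2 t x).mul (cx 1 3 t x)).const_mul (β ^ 3 * ε))).const_mul 4 |>.congr_deriv ?_
    simp only [Pi.pow_apply]
    push_cast
    ring
  · intro t ht x
    have hu : 16 * (β * mixedD u 0 0 t x ^ 2) ≤ ε ^ 2 := by
      simpa only [mixedD_zero_zero] using hsup t ht.1.le x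
    have heq := h.equation ht.1 x
    generalize mixedD u 0 0 t x = a at *
    generalize mixedD u 0 1 t x = b at *
    generalize mixedD u 0 2 t x = c at *
    generalize mixedD u 1 0 t x = p at *
    generalize mixedD u 1 1 t x = q at *
    generalize mixedD u 1 2 t x = r at *
    generalize mixedD u 1 3 t x = s at *
    generalize mixedD u 1 4 t x = w at *
    have hdiss : 0 ≤ 3 * ε * (a * b) ^ 2 + β * ε * q ^ 2 + β ^ 2 * ε * r ^ 2 + β ^ 3 * ε * s ^ 2
        + 3 * β * a ^ 2 * b * q - 3 * β ^ 2 * a ^ 2 * b * s - 2 * β * ε * a * b * r := by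
      refine nonneg_of_mul_nonneg_right (a := 4 * ε) ?_ (by positivity)
      have h1 : 0 ≤ β * (2 * ε * q + 3 * a ^ 2 * b) ^ 2 := by positivity
      have h2 : 0 ≤ β * (2 * β * ε * s - 3 * a ^ 2 * b) ^ 2 := by positivity
      have h3 : 0 ≤ 4 * ε ^ 2 * (β * r - a * b) ^ 2 := by positivity
      have h4 : 0 ≤ ε ^ 2 * (a * b) ^ 2 := by positivity
      have h5 : 0 ≤ (ε ^ 2 - 16 * (β * a ^ 2)) * (a * b) ^ 2 :=
        mul_nonneg (sub_nonneg.2 hu) (sq_nonneg _)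
      nlinarith
    linear_combination 4 * hdiss + 4 * (a ^ 3 - β * ε * r) * heq
  · have d00 := h.tendsto_mixedD hT (j := 0) (k := 0) (by norm_num)
    have d01 := h.tendsto_mixedD hT (j := 0) (k := 1) (by norm_num)
    have d10 := h.tendsto_mixedD hT (j := 1) (k := 0) (by norm_num)
    have d11 := h.tendsto_mixedD hT (j := 1) (k := 1) (by norm_num)
    have d12 := h.tendsto_mixedD hT (j := 1) (k := 2) (by norm_num)
    have d13 := h.tendsto_mixedD hT (j := 1) (k := 3) (by norm_num)
    simpa using ((((((d00.pow 5).const_mul (-(2 / 5))).add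
      (((d00.pow 3).mul d11).const_mul β)).sub
      (((d00.pow 3).mul d13).const_mul (β ^ 2))).add (((d00.pow 3).mul d01).const_mul ε)).add
      ((d11.mul d10).const_mul (β * ε))).add
      ((d12.mul d13).const_mul (β ^ 3 * ε)) |>.const_mul 4

end IsAdmissibleRLW

/-- Uniform `L⁴` bound for the Rosenau–RLW approximation (★★); one may take
`D = 1/(16C₀)`. -/
theorem L4_bound_RLW (C0 : ℝ) (hC0 : 0 < C0) :
    ∃ D : ℝ, D = 1 / (16 * C0) ∧ 0 < D ∧
      ∃ C : ℝ, 0 < C ∧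
        ∀ ε β : ℝ, 0 < ε → 0 < β → β ≤ D ^ 2 * ε ^ 4 →
          ∀ u : ℝ → ℝ → ℝ, IsAdmissibleRLW ε β u →
            DataBoundsRLW ε β C0 (u 0) →
            (sqL2 (u 0) + β * sqL2 (fun x => mixedD u 0 1 0 x)
              + β ^ 2 * sqL2 (fun x => mixedD u 0 2 0 x) ≤ C0) →
            ∀ t > (0 : ℝ), nL4 (u t) ≤ C := by
  refine ⟨1 / (16 * C0), rfl, by positivity, (2 * C0) ^ ((1 : ℝ) / 4), by positivity, ?_⟩
  intro ε β hε hβ hβD u h hdata hE t ht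
  have hsqrt : √β ≤ 1 / (16 * C0) * ε ^ 2 := by
    rw [Real.sqrt_le_left (by positivity)]
    linarith [hβD, mul_pow (1 / (16 * C0)) (ε ^ 2) 2, pow_mul ε 2 2]
  have hsup : ∀ t, 0 ≤ t → ∀ x, 16 * (β * u t x ^ 2) ≤ ε ^ 2 := fun t ht x => by
    have h1 := h.sqrt_mul_sq_le hε.le hβ.le hE ht x
    have h2 : √β * C0 ≤ ε ^ 2 / 16 := by
      calc √β * C0 ≤ 1 / (16 * C0) * ε ^ 2 * C0 := by gcongr
        _ = ε ^ 2 / 16 := by field_simp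
    have h3 := mul_le_mul_of_nonneg_left h1 (Real.sqrt_nonneg β)
    rw [← mul_assoc, Real.mul_self_sqrt hβ.le] at h3
    linarith
  have h4 : ∀ t, 0 ≤ t → Integrable fun x => u t x ^ 4 := fun t ht =>
    h.integrable_pow_four ht (K := ε ^ 2 / (16 * β)) fun x => by
      rw [le_div_iff₀ (by positivity)]
      linarith [hsup t ht x]
  have h2 : ∀ t, 0 ≤ t → Integrable fun x => 2 * β * ε ^ 2 * mixedD u 0 2 t x ^ 2 := fun t ht =>
    (h.integrable_mixedD_sq ht (by norm_num)).const_mul _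
  have hmain := h.integral_pow_four_add_le hε hβ hsup ht
  rw [integral_add (h4 t ht.le) (h2 t ht.le), integral_add (h4 0 le_rfl) (h2 0 le_rfl),
    integral_const_mul, integral_const_mul] at hmain
  have hn1 : 0 ≤ 2 * β * ε ^ 2 * ∫ x, mixedD u 0 2 t x ^ 2 :=
    mul_nonneg (by positivity) (integral_nonneg fun x => sq_nonneg _)
  have hn2 : 0 ≤ ∫ x, u 0 x ^ 2 := integral_nonneg fun x => sq_nonneg _
  have hn3 : 0 ≤ ∫ x, u 0 x ^ 4 := integral_nonneg fun x => by positivity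
  have hd : (∫ x, u 0 x ^ 2) + (∫ x, u 0 x ^ 4) + β * ε ^ 2 * (∫ x, mixedD u 0 2 0 x ^ 2) ≤ C0 :=
    hdata
  exact Real.rpow_le_rpow (integral_nonneg fun x => by positivity) (by linarith) (by norm_num)

end
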